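/- Let G=(V,E) be a finite simple bipartite graph with color classes V⁺ and V⁻, and let F ⊆ E be a 2-matching. Then F contains a cycle of length congruent to 2 modulo 4 (i.e., of length 4k+2 for some positive integer k) if and only if there exists U ⊆ V with |U ∩ V⁺| = |U ∩ V⁻| odd such that F[U] is a 2-factor of the induced subgraph G[U]. Consequently, F is C_{4k+2}-free if and only if F is U-feasible for U = { U ⊆ V : |U ∩ V⁺| = |U ∩ V⁻| = 2k+1 for some positive integer k }. -/

import Mathlib

open scoped Classical

noncomputable section

variable {V : Type*} [Fintype V] [DecidableEq V]

/-- `deg_F(v)`: the number of edges of `F` incident to the vertex `v`. -/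
def degF (F : Finset (Sym2 V)) (v : V) : ℕ := (F.filter (fun e => v ∈ e)).card

/-- `F[X]`: the set of edges of `F` with both endpoints in `X`. -/
def inducedEdges (F : Finset (Sym2 V)) (X : Finset V) : Finset (Sym2 V) :=
  F.filter (fun e => ∀ v ∈ e, v ∈ X)

/-- `F[X,Y]`: the set of edges of `F` with one endpoint in `X` and the other in `Y`. -/
def crossEdges (F : Finset (Sym2 V)) (X Y : Finset V) : Finset (Sym2 V) :=
  F.filter (fun e => ∃ u ∈ X, ∃ v ∈ Y, e = s(u, v))

/-- `F` is a `t`-matching: every vertex is incident to at most `t` edges of `F`. -/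
def IsTMatching (F : Finset (Sym2 V)) (t : ℕ) : Prop := ∀ v : V, degF F v ≤ t

/-- `F[U]` is a `t`-factor of the induced subgraph on `U`:
every vertex of `U` is incident to exactly `t` edges of `F[U]`. -/
def IsTFactorOn (F : Finset (Sym2 V)) (U : Finset V) (t : ℕ) : Prop :=
  ∀ v ∈ U, degF (inducedEdges F U) v = t

/-- `⌊(t·|U| - 1)/2⌋` as an integer. -/
def ufBound (t : ℕ) (U : Finset V) : ℤ := ⌊((t * U.card - 1 : ℚ) / 2)⌋

/-- A `t`-matching `F` is `𝒰`-feasible if `|F[U]| ≤ ⌊(t·|U| - 1)/2⌋` for every `U ∈ 𝒰`. -/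
def IsUFeasible (F : Finset (Sym2 V)) (𝒰 : Finset (Finset V)) (t : ℕ) : Prop :=
  ∀ U ∈ 𝒰, ((inducedEdges F U).card : ℤ) ≤ ufBound t U

theorem degF_eq_card_filter (F : Finset (Sym2 V)) (v : V) :
    degF F v = (Finset.univ.filter (fun w => s(v, w) ∈ F)).card := by
  symm
  refine Finset.card_bij (fun w _ => s(v, w)) ?_ ?_ ?_
  · intro w hw
    simpa using hw
  · intro a _ b _ h
    exact Sym2.congr_right.mp h
  · intro e he
    obtain ⟨heF, hve⟩ := Finset.mem_filter.mp he
    obtain ⟨w, rfl⟩ := hve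
    exact ⟨w, by simpa using heF, rfl⟩

theorem mk_mem_inducedEdges {F : Finset (Sym2 V)} {U : Finset V} {u v : V} :
    s(u, v) ∈ inducedEdges F U ↔ s(u, v) ∈ F ∧ u ∈ U ∧ v ∈ U := by
  simp [inducedEdges]

theorem degF_mono {F F' : Finset (Sym2 V)} (h : F ⊆ F') (v : V) : degF F v ≤ degF F' v :=
  Finset.card_le_card (Finset.filter_subset_filter _ h)

theorem inducedEdges_subset (F : Finset (Sym2 V)) (U : Finset V) : inducedEdges F U ⊆ F :=
  Finset.filter_subset _ _

theorem sum_degF_eq_card {F : Finset (Sym2 V)} {S : Finset V}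
    (h : ∀ e ∈ F, (S.filter (fun v => v ∈ e)).card = 1) : ∑ v ∈ S, degF F v = F.card := by
  rw [Finset.card_eq_sum_ones, ← Finset.sum_congr rfl h]
  exact Finset.sum_card_bipartiteAbove_eq_sum_card_bipartiteBelow (fun v e => v ∈ e)

/-- Every edge of `F` has exactly one endpoint in `Vp`. -/
def IsBipartiteEdgeSet (F : Finset (Sym2 V)) (Vp : Finset V) : Prop :=
  ∀ u v : V, s(u, v) ∈ F → (u ∈ Vp ↔ v ∉ Vp)

theorem IsBipartiteEdgeSet.sum_degF_inter {F : Finset (Sym2 V)} {Vp : Finset V}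
    (hF : IsBipartiteEdgeSet F Vp) (U : Finset V) :
    ∑ v ∈ U ∩ Vp, degF (inducedEdges F U) v = (inducedEdges F U).card := by
  refine sum_degF_eq_card fun e => ?_
  induction e with | _ a b
  intro he
  obtain ⟨hab, ha, hb⟩ := mk_mem_inducedEdges.mp he
  have hab := hF a b hab
  rw [Finset.card_eq_one]
  by_cases hp : a ∈ Vp
  · exact ⟨a, by ext x; simp; grind⟩
  · exact ⟨b, by ext x; simp; grind⟩

theorem IsBipartiteEdgeSet.sum_degF_sdiff {F : Finset (Sym2 V)} {Vp : Finset V}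
    (hF : IsBipartiteEdgeSet F Vp) (U : Finset V) :
    ∑ v ∈ U \ Vp, degF (inducedEdges F U) v = (inducedEdges F U).card := by
  have hFc : IsBipartiteEdgeSet F Vpᶜ := fun u v h => by
    have := hF u v h
    simp only [Finset.mem_compl]
    tauto
  rw [Finset.sdiff_eq_inter_compl]
  exact hFc.sum_degF_inter U

theorem IsTFactorOn.two_mul_card_inter {F : Finset (Sym2 V)} {U Vp : Finset V}
    (hU : IsTFactorOn F U 2) (hF : IsBipartiteEdgeSet F Vp) :
    2 * (U ∩ Vp).card = (inducedEdges F U).card := by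
  rw [← hF.sum_degF_inter U,
    Finset.sum_congr rfl fun v hv => hU v (Finset.mem_of_mem_inter_left hv)]
  simp [mul_comm]

theorem IsTFactorOn.two_mul_card_sdiff {F : Finset (Sym2 V)} {U Vp : Finset V}
    (hU : IsTFactorOn F U 2) (hF : IsBipartiteEdgeSet F Vp) :
    2 * (U \ Vp).card = (inducedEdges F U).card := by
  rw [← hF.sum_degF_sdiff U,
    Finset.sum_congr rfl fun v hv => hU v (Finset.mem_sdiff.mp hv).1]
  simp [mul_comm]

theorem IsTFactorOn.card_eq {F : Finset (Sym2 V)} {U Vp : Finset V}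
    (hU : IsTFactorOn F U 2) (hF : IsBipartiteEdgeSet F Vp) :
    (U ∩ Vp).card = (U \ Vp).card ∧ U.card = 2 * (U ∩ Vp).card := by
  have h₁ := hU.two_mul_card_inter hF
  have h₂ := hU.two_mul_card_sdiff hF
  have h₃ := Finset.card_inter_add_card_sdiff U Vp
  omega

/-- A `2`-matching with at least `|U|` edges inside `U` is a `2`-factor on `U`, provided that
the bipartition splits `U` evenly. -/
theorem IsTMatching.isTFactorOn_of_card_le {F : Finset (Sym2 V)} {U Vp : Finset V}
    (hM : IsTMatching F 2) (hF : IsBipartiteEdgeSet F Vp)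
    (hcard : (U ∩ Vp).card = (U \ Vp).card) (hle : U.card ≤ (inducedEdges F U).card) :
    IsTFactorOn F U 2 := by
  have hdeg (v : V) : degF (inducedEdges F U) v ≤ 2 :=
    (degF_mono (inducedEdges_subset F U) v).trans (hM v)
  have hU := Finset.card_inter_add_card_sdiff U Vp
  have key (S : Finset V) (hS : 2 * S.card ≤ ∑ v ∈ S, degF (inducedEdges F U) v) :
      ∀ v ∈ S, degF (inducedEdges F U) v = 2 := by
    refine (Finset.sum_eq_sum_iff_of_le fun v _ => hdeg v).mp ?_
    refine le_antisymm (Finset.sum_le_sum fun v _ => hdeg v) ?_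
    simpa [mul_comm] using hS
  intro v hv
  by_cases hp : v ∈ Vp
  · exact key (U ∩ Vp) (by rw [hF.sum_degF_inter]; omega) v (by simp [hv, hp])
  · exact key (U \ Vp) (by rw [hF.sum_degF_sdiff]; omega) v (by simp [hv, hp])

/-- Deleting a `2`-factor on `W` from a `2`-factor on `U` leaves a `2`-factor on `U \ W`. -/
theorem IsTFactorOn.sdiff {F : Finset (Sym2 V)} {U W : Finset V} (hM : IsTMatching F 2)
    (hU : IsTFactorOn F U 2) (hW : IsTFactorOn F W 2) : IsTFactorOn F (U \ W) 2 := by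
  have hsat {u w : V} (hw : w ∈ W) (huw : s(u, w) ∈ F) : u ∈ W := by
    have heq : (inducedEdges F W).filter (fun e => w ∈ e) = F.filter (fun e => w ∈ e) :=
      Finset.eq_of_subset_of_card_le (Finset.filter_subset_filter _ (inducedEdges_subset F W))
        ((hM w).trans (hW w hw).ge)
    have hmem : s(u, w) ∈ F.filter (fun e => w ∈ e) := by simp [huw]
    rw [← heq] at hmem
    exact (mk_mem_inducedEdges.mp (Finset.mem_filter.mp hmem).1).2.1
  intro v hv
  obtain ⟨hvU, hvW⟩ := Finset.mem_sdiff.mp hv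
  rw [← hU v hvU, degF_eq_card_filter, degF_eq_card_filter]
  congr 1
  ext w
  simp only [Finset.mem_filter, Finset.mem_univ, true_and, mk_mem_inducedEdges, Finset.mem_sdiff]
  refine ⟨by tauto, fun ⟨hF, _, hwU⟩ => ⟨hF, ⟨hvU, hvW⟩, hwU, fun hw => hvW (hsat hw hF)⟩⟩

theorem SimpleGraph.Walk.IsCycle.card_support_toFinset {G : SimpleGraph V} {v : V}
    {c : G.Walk v v} (hc : c.IsCycle) : c.support.toFinset.card = c.length := by
  have h : c.support.toFinset = c.support.tail.toFinset := by
    ext x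
    have hv : v ∈ c.support.tail := c.end_mem_tail_support hc.not_nil
    rw [List.mem_toFinset, List.mem_toFinset, c.mem_support_iff]
    grind
  rw [h, List.toFinset_card_of_nodup hc.support_nodup]
  simp

/-- The vertex set of a cycle in a `2`-matching carries a `2`-factor. -/
theorem IsTMatching.isTFactorOn_support {F : Finset (Sym2 V)} (hM : IsTMatching F 2) {v : V}
    {c : (SimpleGraph.fromEdgeSet (↑F : Set (Sym2 V))).Walk v v} (hc : c.IsCycle) :
    IsTFactorOn F c.support.toFinset 2 := by
  intro u hu
  refine le_antisymm ((degF_mono (inducedEdges_subset F _) u).trans (hM u)) ?_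
  rw [← hc.ncard_neighborSet_toSubgraph_eq_two (List.mem_toFinset.mp hu), degF_eq_card_filter,
    ← Set.ncard_coe_finset]
  refine Set.ncard_le_ncard (fun w hw => ?_) (Finset.finite_toSet _)
  have hadj : c.toSubgraph.Adj u w := hw
  have hw : w ∈ c.support := c.mem_verts_toSubgraph.mp hadj.snd_mem
  have hF := (SimpleGraph.fromEdgeSet_adj _).mp hadj.adj_sub
  simpa [mk_mem_inducedEdges, hw, List.mem_toFinset.mp hu] using hF.1

/-- A finite nonempty graph in which every vertex has two distinct neighbours has a cycle. -/
theorem SimpleGraph.not_isAcyclic_of_forall_exists_ne_adj {W : Type*} [Finite W] [Nonempty W]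
    {G : SimpleGraph W} (h : ∀ v, ∃ a b, a ≠ b ∧ G.Adj v a ∧ G.Adj v b) : ¬ G.IsAcyclic := by
  intro hG
  obtain ⟨u, v, p, hp, hmax⟩ := SimpleGraph.Walk.exists_isPath_forall_isPath_length_le_length G
  have hsnd {w : W} (hadj : G.Adj u w) : w = p.snd := by
    refine hG.eq_snd_of_adj_start hp hadj ?_
    by_contra hw
    have := hmax _ _ _ (hp.cons (h := hadj.symm) hw)
    simp at this
  obtain ⟨a, b, hab, ha, hb⟩ := h u
  exact hab ((hsnd ha).trans (hsnd hb).symm)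

/-- A nonempty `2`-factor on `U` contains a cycle all of whose vertices lie in `U`. -/
theorem IsTFactorOn.exists_isCycle {F : Finset (Sym2 V)} {U : Finset V}
    (hloop : ∀ v, s(v, v) ∉ F) (hU : IsTFactorOn F U 2) (hne : U.Nonempty) :
    ∃ (v : V) (c : (SimpleGraph.fromEdgeSet (↑F : Set (Sym2 V))).Walk v v),
      c.IsCycle ∧ c.support.toFinset ⊆ U := by
  set H := SimpleGraph.fromEdgeSet (↑F : Set (Sym2 V))
  have hHU : ¬ (H.induce (U : Set V)).IsAcyclic := by
    have : Nonempty (U : Set V) := hne.to_subtype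
    refine SimpleGraph.not_isAcyclic_of_forall_exists_ne_adj fun v => ?_
    have hv := hU v v.2
    rw [degF_eq_card_filter, Finset.card_eq_two] at hv
    obtain ⟨a, b, hab, heq⟩ := hv
    have hadj {w : V} (hw : w ∈ ({a, b} : Finset V)) : w ∈ U ∧ H.Adj v w := by
      rw [← heq, Finset.mem_filter, mk_mem_inducedEdges] at hw
      refine ⟨hw.2.2.2, (SimpleGraph.fromEdgeSet_adj _).mpr ⟨hw.2.1, ?_⟩⟩
      intro hvw
      exact hloop _ (hvw ▸ hw.2.1)
    have ha := hadj (w := a) (by simp)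
    have hb := hadj (w := b) (by simp)
    exact ⟨⟨a, ha.1⟩, ⟨b, hb.1⟩, by simpa using hab, ha.2, hb.2⟩
  simp only [SimpleGraph.IsAcyclic, not_forall, not_not] at hHU
  obtain ⟨v, c, hc⟩ := hHU
  let f := (SimpleGraph.Embedding.induce (G := H) (U : Set V)).toHom
  refine ⟨f v, c.map f, hc.map Subtype.val_injective, fun x hx => ?_⟩
  rw [List.mem_toFinset, SimpleGraph.Walk.support_map, List.mem_map] at hx
  obtain ⟨y, _, rfl⟩ := hx
  exact y.2

/-- A `2`-factor on a set of `4m + 2` vertices of a bipartite `2`-matching contains a cycle whose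
length is congruent to `2` modulo `4`. -/
theorem IsTFactorOn.exists_isCycle_length {F : Finset (Sym2 V)} {Vp : Finset V}
    (hM : IsTMatching F 2) (hF : IsBipartiteEdgeSet F Vp) {U : Finset V}
    (hU : IsTFactorOn F U 2) (hcard : U.card % 4 = 2) :
    ∃ (v : V) (c : (SimpleGraph.fromEdgeSet (↑F : Set (Sym2 V))).Walk v v),
      c.IsCycle ∧ ∃ k : ℕ, 0 < k ∧ c.length = 4 * k + 2 := by
  induction U using Finset.strongInduction with
  | H U ih =>
    have hloop (v : V) : s(v, v) ∉ F := fun h => by have := hF v v h; tauto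
    have hne : U.Nonempty := Finset.card_pos.mp (by omega)
    obtain ⟨v, c, hc, hsub⟩ := hU.exists_isCycle hloop hne
    have hlen := hc.card_support_toFinset
    have hthree := hc.three_le_length
    have hW := hM.isTFactorOn_support hc
    have heven := (hW.card_eq hF).2
    by_cases hmod : c.length % 4 = 2
    · exact ⟨v, c, hc, c.length / 4, by omega, by omega⟩
    · have hsdiff := Finset.card_sdiff_add_card_eq_card hsub
      refine ih (U \ c.support.toFinset) ?_ (hU.sdiff hM hW) (by omega)
      exact Finset.sdiff_ssubset hsub (Finset.card_pos.mp (by omega))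

theorem ufBound_two (U : Finset V) : ufBound 2 U = U.card - 1 := by
  rw [ufBound, Int.floor_eq_iff]
  push_cast
  constructor <;> linarith

/-- In a bipartite graph `G` with color classes `Vp` and `Vpᶜ`, a `2`-matching `F`
contains a cycle of length `4k+2` (for some positive integer `k`) iff there is `U ⊆ V`
with `|U ∩ V⁺| = |U ∩ V⁻|` odd such that `F[U]` is a `2`-factor of `G[U]`;
consequently, `F` is `C_{4k+2}`-free iff `F` is `𝒰`-feasible for
`𝒰 = { U : |U ∩ V⁺| = |U ∩ V⁻| = 2k+1 for some positive integer k }`. -/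
theorem c4k2_free_iff_feasible (G : SimpleGraph V) (Vp : Finset V)
    (hbip : ∀ u v : V, G.Adj u v → (u ∈ Vp ↔ v ∉ Vp))
    (F : Finset (Sym2 V)) (hFE : F ⊆ G.edgeFinset) (hFmatch : IsTMatching F 2) :
    ((∃ (v : V) (c : (SimpleGraph.fromEdgeSet (↑F : Set (Sym2 V))).Walk v v),
        c.IsCycle ∧ ∃ k : ℕ, 0 < k ∧ c.length = 4 * k + 2) ↔
      (∃ U : Finset V, (U ∩ Vp).card = (U \ Vp).card ∧ Odd (U ∩ Vp).card ∧
        IsTFactorOn F U 2)) ∧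
    ((¬ ∃ (v : V) (c : (SimpleGraph.fromEdgeSet (↑F : Set (Sym2 V))).Walk v v),
        c.IsCycle ∧ ∃ k : ℕ, 0 < k ∧ c.length = 4 * k + 2) ↔
      IsUFeasible F
        ((Finset.univ : Finset (Finset V)).filter
          (fun U => ∃ k : ℕ, 0 < k ∧ (U ∩ Vp).card = 2 * k + 1 ∧
            (U \ Vp).card = 2 * k + 1)) 2) := by
  have hF : IsBipartiteEdgeSet F Vp := fun u v h =>
    hbip u v (SimpleGraph.mem_edgeFinset.mp (hFE h))
  have hfactor_of_cycle : (∃ (v : V) (c : (SimpleGraph.fromEdgeSet (↑F : Set (Sym2 V))).Walk v v),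
      c.IsCycle ∧ ∃ k : ℕ, 0 < k ∧ c.length = 4 * k + 2) →
      ∃ U : Finset V, IsTFactorOn F U 2 ∧ ∃ k : ℕ, 0 < k ∧ (U ∩ Vp).card = 2 * k + 1 ∧
        (U \ Vp).card = 2 * k + 1 := by
    rintro ⟨v, c, hc, k, hk, hlen⟩
    have hU := hFmatch.isTFactorOn_support hc
    obtain ⟨h₁, h₂⟩ := hU.card_eq hF
    have h₃ := hc.card_support_toFinset
    exact ⟨c.support.toFinset, hU, k, hk, by omega, by omega⟩
  have hcycle_of_factor {U : Finset V} (hU : IsTFactorOn F U 2) (hodd : Odd (U ∩ Vp).card) :=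
    hU.exists_isCycle_length hFmatch hF (by
      obtain ⟨m, hm⟩ := hodd
      have := (hU.card_eq hF).2
      omega)
  refine ⟨⟨fun h => ?_, fun ⟨U, _, hodd, hU⟩ => hcycle_of_factor hU hodd⟩,
    fun h U hU => ?_, fun h hc => ?_⟩
  · obtain ⟨U, hU, k, _, h₁, h₂⟩ := hfactor_of_cycle h
    exact ⟨U, h₁.trans h₂.symm, ⟨k, h₁⟩, hU⟩
  · obtain ⟨k, _, h₁, h₂⟩ := (Finset.mem_filter.mp hU).2
    by_contra hlt
    rw [ufBound_two] at hlt
    exact h (hcycle_of_factor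
      (hFmatch.isTFactorOn_of_card_le hF (h₁.trans h₂.symm) (by omega)) ⟨k, h₁⟩)
  · obtain ⟨U, hU, hk⟩ := hfactor_of_cycle hc
    have hle := h U (Finset.mem_filter.mpr ⟨Finset.mem_univ U, hk⟩)
    rw [ufBound_two] at hle
    have h₁ := hU.two_mul_card_inter hF
    have h₂ := (hU.card_eq hF).2
    omega
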